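/- (Theorem 4.1, part 4: eventual exponential-asymptotic stability in the large) Under the standing hypotheses with ρ = ∞ (i.e. F'(z) ≤ k for all z ∈ ℝ) and 0 ≤ τ < 1, if sup_{t>0} g(t) < ∞ and C'(t) → 0 as t → ∞, then the null solution is eventually exponential-asymptotically stable in the large: for every δ > 0 there exist s(δ) ≥ 0 and positive constants D(δ), E(δ) such that for every t₀ ≥ s(δ) every classical solution u on [t₀,∞) with d(t₀) ≤ δ satisfies d(t) ≤ D(δ)·exp(−E(δ)(t − t₀))·d(t₀) for all t ≥ t₀. -/

import Mathlib

open Real Set MeasureTheory Filter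

/-- A classical solution on `[t₀, ∞)` of the initial-boundary-value problem
`-ε(t) u_xxt + u_tt - C(t) u_xx + a' u_t = F(u) - a u_t` on `(0,π) × (t₀,∞)`,
with Dirichlet boundary conditions `u(0,t) = u(π,t) = 0`.  The partial
derivatives are recorded as data, together with the hypotheses that they really
are the derivatives and that all of them are continuous on the closed
space-time domain. -/
structure ClassicalSolution (ε C F : ℝ → ℝ) (a' t₀ : ℝ) where
  u : ℝ → ℝ → ℝ
  ux : ℝ → ℝ → ℝ
  uxx : ℝ → ℝ → ℝ
  ut : ℝ → ℝ → ℝ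
  utt : ℝ → ℝ → ℝ
  uxxt : ℝ → ℝ → ℝ
  aa : ℝ → ℝ → ℝ
  hux : ∀ t ∈ Ici t₀, ∀ x ∈ Icc (0:ℝ) π,
    HasDerivWithinAt (fun y => u y t) (ux x t) (Icc 0 π) x
  huxx : ∀ t ∈ Ici t₀, ∀ x ∈ Icc (0:ℝ) π,
    HasDerivWithinAt (fun y => ux y t) (uxx x t) (Icc 0 π) x
  hut : ∀ x ∈ Icc (0:ℝ) π, ∀ t ∈ Ici t₀,
    HasDerivWithinAt (fun s => u x s) (ut x t) (Ici t₀) t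
  hutt : ∀ x ∈ Icc (0:ℝ) π, ∀ t ∈ Ici t₀,
    HasDerivWithinAt (fun s => ut x s) (utt x t) (Ici t₀) t
  huxxt : ∀ x ∈ Icc (0:ℝ) π, ∀ t ∈ Ici t₀,
    HasDerivWithinAt (fun s => uxx x s) (uxxt x t) (Ici t₀) t
  cont_u : ContinuousOn (Function.uncurry u) (Icc 0 π ×ˢ Ici t₀)
  cont_ux : ContinuousOn (Function.uncurry ux) (Icc 0 π ×ˢ Ici t₀)
  cont_uxx : ContinuousOn (Function.uncurry uxx) (Icc 0 π ×ˢ Ici t₀)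
  cont_ut : ContinuousOn (Function.uncurry ut) (Icc 0 π ×ˢ Ici t₀)
  cont_utt : ContinuousOn (Function.uncurry utt) (Icc 0 π ×ˢ Ici t₀)
  cont_uxxt : ContinuousOn (Function.uncurry uxxt) (Icc 0 π ×ˢ Ici t₀)
  cont_aa : ContinuousOn (Function.uncurry aa) (Icc 0 π ×ˢ Ici t₀)
  aa_nonneg : ∀ x ∈ Icc (0:ℝ) π, ∀ t ∈ Ici t₀, 0 ≤ aa x t
  pde : ∀ x ∈ Ioo (0:ℝ) π, ∀ t ∈ Ioi t₀,
    -(ε t) * uxxt x t + utt x t - C t * uxx x t + a' * ut x t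
      = F (u x t) - aa x t * ut x t
  bc0 : ∀ t ∈ Ici t₀, u 0 t = 0
  bcπ : ∀ t ∈ Ici t₀, u π t = 0

/-- The time-dependent norm `d(t)` of a solution:
`d(t)² = ∫₀^π [ε(t)² u_xx² + u_x² + u² + u_t²] dx`. -/
noncomputable def ClassicalSolution.d {ε C F : ℝ → ℝ} {a' t₀ : ℝ}
    (S : ClassicalSolution ε C F a' t₀) (t : ℝ) : ℝ :=
  Real.sqrt (∫ x in (0:ℝ)..π,
    ((ε t)^2 * (S.uxx x t)^2 + (S.ux x t)^2 + (S.u x t)^2 + (S.ut x t)^2))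


lemma ftc_icc {f f' : ℝ → ℝ} {a b : ℝ} (hab : a ≤ b)
    (hf : ∀ x ∈ Icc a b, HasDerivWithinAt f (f' x) (Icc a b) x)
    (hc : ContinuousOn f' (Icc a b)) : ∫ x in a..b, f' x = f b - f a := by
  apply intervalIntegral.integral_eq_sub_of_hasDerivAt_of_le hab
  · exact fun x hx => (hf x hx).continuousWithinAt
  · intro x hx
    exact (hf x (Ioo_subset_Icc_self hx)).hasDerivAt (Icc_mem_nhds hx.1 hx.2)
  · rw [← uIcc_of_le hab] at hc
    exact hc.intervalIntegrable

lemma wirtinger {f f' : ℝ → ℝ}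
    (hf : ∀ x ∈ Icc 0 π, HasDerivWithinAt f (f' x) (Icc 0 π) x)
    (hc : ContinuousOn f' (Icc 0 π)) (h0 : f 0 = 0) (h1 : f π = 0) :
    ∫ x in (0:ℝ)..π, (f x)^2 ≤ ∫ x in (0:ℝ)..π, (f' x)^2 := by
  have hpi := Real.pi_pos
  have hfc : ContinuousOn f (Icc 0 π) := fun x hx => (hf x hx).continuousWithinAt
  have key : ∀ l ∈ Ioo (0:ℝ) 1,
      l^2 * ∫ x in (0:ℝ)..π, (f x)^2 ≤ ∫ x in (0:ℝ)..π, (f' x)^2 := by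
    intro l hl
    have hcos : ∀ x ∈ Icc 0 π, cos (l * (x - π/2)) ≠ 0 := by
      intro x hx
      apply ne_of_gt
      apply Real.cos_pos_of_mem_Ioo
      constructor <;> nlinarith [hx.1, hx.2, hl.1, hl.2]
    set T : ℝ → ℝ := fun x => tan (l * (x - π/2)) with hT
    have hTd : ∀ x ∈ Icc 0 π, HasDerivAt T (l * (1 + T x ^2)) x := by
      intro x hx
      have h1 := Real.hasDerivAt_tan (hcos x hx)
      have h2 : HasDerivAt (fun x => l * (x - π/2)) l x := by
        simpa using ((hasDerivAt_id x).sub_const (π/2)).const_mul l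
      have h3 := h1.comp x h2
      refine h3.congr_deriv ?_
      have : 1 + T x ^ 2 = 1 / cos (l * (x - π/2))^2 := by
        simp only [hT, Real.tan_eq_sin_div_cos]
        have := hcos x hx
        have h4 := Real.cos_sq_add_sin_sq (l * (x - π/2))
        generalize cos (l * (x - π/2)) = c at *
        generalize sin (l * (x - π/2)) = d at *
        field_simp
        exact h4
      rw [this]; ring
    have hTc : ContinuousOn T (Icc 0 π) := fun x hx => (hTd x hx).continuousAt.continuousWithinAt
    have hb := ftc_icc (f := fun x => l * f x^2 * T x)
      (f' := fun x => l * (2 * f x * f' x) * T x + l * f x^2 * (l * (1 + T x ^2))) hpi.le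
      (fun x hx => by
        have h1 := (((hf x hx).pow 2).const_mul l).mul ((hTd x hx).hasDerivWithinAt)
        refine h1.congr_deriv ?_
        simp; try ring) (by fun_prop)
    simp only [h0, h1] at hb
    have : 0 ≤ ∫ x in (0:ℝ)..π, (f' x + l * f x * T x)^2 :=
      intervalIntegral.integral_nonneg hpi.le (fun x _ => sq_nonneg _)
    have e : ∫ x in (0:ℝ)..π, (f' x + l * f x * T x)^2 =
      ((∫ x in (0:ℝ)..π, (f' x)^2) - l^2 * ∫ x in (0:ℝ)..π, (f x)^2) +
      ∫ x in (0:ℝ)..π, (l * (2 * f x * f' x) * T x + l * f x^2 * (l * (1 + T x ^2))) := by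
      rw [← uIcc_of_le hpi.le] at hc hfc hTc
      rw [← intervalIntegral.integral_const_mul, ← intervalIntegral.integral_sub,
        ← intervalIntegral.integral_add]
      · congr 1; ext x; ring
      all_goals apply ContinuousOn.intervalIntegrable; fun_prop
    rw [e, hb] at this
    linarith
  have ht : Tendsto (fun l : ℝ => l^2 * ∫ x in (0:ℝ)..π, (f x)^2) (nhdsWithin 1 (Iio 1))
      (nhds (1^2 * ∫ x in (0:ℝ)..π, (f x)^2)) :=
    (Continuous.tendsto (by fun_prop) 1).mono_left nhdsWithin_le_nhds
  rw [one_pow, one_mul] at ht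
  refine le_of_tendsto ht ?_
  filter_upwards [Ioo_mem_nhdsLT (zero_lt_one' ℝ)] with l hl using key l hl

lemma cont_int {f : ℝ → ℝ → ℝ} {a b t₀ : ℝ} (hab : a ≤ b)
    (hf : ContinuousOn (Function.uncurry f) (Icc a b ×ˢ Ici t₀)) :
    ContinuousOn (fun t => ∫ x in a..b, f x t) (Ici t₀) := by
  have h : Continuous (fun p : ℝ × ℝ => f (projIcc a b hab p.2) (max t₀ p.1)) := by
    apply hf.comp_continuous (f := fun p : ℝ × ℝ => (((projIcc a b hab p.2 : ℝ)), max t₀ p.1))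
    · fun_prop
    · intro p; exact ⟨(projIcc a b hab p.2).2, mem_Ici.2 (le_max_left _ _)⟩
  have h2 : Continuous (fun t => ∫ x in a..b, f (projIcc a b hab x) (max t₀ t)) :=
    intervalIntegral.continuous_parametric_intervalIntegral_of_continuous' h a b
  refine h2.continuousOn.congr ?_
  intro t ht
  apply intervalIntegral.integral_congr
  intro x hx
  rw [uIcc_of_le hab] at hx
  simp only [projIcc_of_mem hab hx, max_eq_right (mem_Ici.1 ht)]

lemma diff_int {f ft : ℝ → ℝ → ℝ} {a b t₀ t : ℝ} (hab : a ≤ b) (ht : t₀ < t)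
    (hf : ContinuousOn (Function.uncurry f) (Icc a b ×ˢ Ici t₀))
    (hft : ContinuousOn (Function.uncurry ft) (Icc a b ×ˢ Ici t₀))
    (hd : ∀ x ∈ Icc a b, ∀ s, t₀ < s → HasDerivAt (fun r => f x r) (ft x s) s) :
    HasDerivAt (fun s => ∫ x in a..b, f x s) (∫ x in a..b, ft x t) t := by
  have sec : ∀ g : ℝ → ℝ → ℝ, ContinuousOn (Function.uncurry g) (Icc a b ×ˢ Ici t₀) →
      ∀ s, t₀ ≤ s → ContinuousOn (fun x => g x s) (Icc a b) := by
    intro g hg s hs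
    exact hg.comp (f := fun x => (x, s)) (by fun_prop) (fun x hx => ⟨hx, hs⟩)
  have hK : IsCompact (Icc a b ×ˢ Icc t₀ (t+1)) := isCompact_Icc.prod isCompact_Icc
  obtain ⟨B, hB⟩ := hK.exists_bound_of_continuousOn
    (hft.mono (prod_mono_right Icc_subset_Ici_self))
  have hio : uIoc a b ⊆ Icc a b := by
    rw [uIoc_of_le hab]; exact Ioc_subset_Icc_self
  refine (intervalIntegral.hasDerivAt_integral_of_dominated_loc_of_deriv_le
    (F := fun s x => f x s) (F' := fun s x => ft x s) (x₀ := t) (bound := fun _ => B)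
    (s := Ioo t₀ (t+1)) (Ioo_mem_nhds ht (by linarith)) ?_ ?_ ?_ ?_ ?_ ?_).2
  · filter_upwards [Ioi_mem_nhds ht] with s hs
    exact ((sec f hf s (le_of_lt hs)).mono hio).aestronglyMeasurable measurableSet_uIoc
  · have := sec f hf t ht.le
    rw [← uIcc_of_le hab] at this
    exact this.intervalIntegrable
  · exact ((sec ft hft t ht.le).mono hio).aestronglyMeasurable measurableSet_uIoc
  · refine Eventually.of_forall fun x hx s hs => ?_
    exact hB (x, s) ⟨hio hx, hs.1.le, hs.2.le⟩
  · exact intervalIntegrable_const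
  · refine Eventually.of_forall fun x hx s hs => ?_
    exact hd x (hio hx) s hs.1

lemma by_parts {f f' g g' : ℝ → ℝ}
    (hf : ∀ x ∈ Icc 0 π, HasDerivWithinAt f (f' x) (Icc 0 π) x)
    (hf' : ContinuousOn f' (Icc 0 π)) (h0 : f 0 = 0) (h1 : f π = 0)
    (hg : ∀ x ∈ Icc 0 π, HasDerivWithinAt g (g' x) (Icc 0 π) x)
    (hg' : ContinuousOn g' (Icc 0 π)) :
    ∫ x in (0:ℝ)..π, (f x * g' x + f' x * g x) = 0 := by
  have hfc : ContinuousOn f (Icc 0 π) := fun x hx => (hf x hx).continuousWithinAt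
  have hgc : ContinuousOn g (Icc 0 π) := fun x hx => (hg x hx).continuousWithinAt
  have := ftc_icc (f := fun x => f x * g x) (f' := fun x => f x * g' x + f' x * g x)
    Real.pi_pos.le (fun x hx => ((hf x hx).mul (hg x hx)).congr_deriv (by ring)) (by fun_prop)
  rw [this, h0, h1]; ring

lemma ii {f : ℝ → ℝ} (h : ContinuousOn f (Icc 0 π)) : IntervalIntegrable f volume 0 π := by
  rw [← uIcc_of_le Real.pi_pos.le] at h
  exact h.intervalIntegrable

lemma green {f f' f'' : ℝ → ℝ}
    (hf : ∀ x ∈ Icc 0 π, HasDerivWithinAt f (f' x) (Icc 0 π) x)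
    (hf' : ∀ x ∈ Icc 0 π, HasDerivWithinAt f' (f'' x) (Icc 0 π) x)
    (hf'' : ContinuousOn f'' (Icc 0 π)) (h0 : f 0 = 0) (h1 : f π = 0) :
    ∀ x ∈ Icc 0 π, f x = (∫ y in (0:ℝ)..x, (x - y) * f'' y)
      - (x / π) * ∫ y in (0:ℝ)..π, (π - y) * f'' y := by
  have key : ∀ x ∈ Icc 0 π, (∫ y in (0:ℝ)..x, (x - y) * f'' y) = f x - x * f' 0 := by
    intro x hx
    have hs : Icc 0 x ⊆ Icc 0 π := Icc_subset_Icc_right hx.2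
    have := ftc_icc (f := fun y => (x - y) * f' y + f y) (f' := fun y => (x - y) * f'' y) hx.1
      (fun y hy => by
        have := ((((hasDerivWithinAt_id y (Icc 0 x)).const_sub x).mul
          ((hf' y (hs hy)).mono hs)).add ((hf y (hs hy)).mono hs))
        refine this.congr_deriv ?_
        simp) ((continuousOn_const.sub continuousOn_id).mul (hf''.mono hs))
    rw [this, h0]; ring
  intro x hx
  rw [key x hx, key π ⟨Real.pi_pos.le, le_rfl⟩, h1]
  field_simp
  ring

section
variable {ε C F : ℝ → ℝ} {a' t₀ : ℝ} (S : ClassicalSolution ε C F a' t₀)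

lemma csec {g : ℝ → ℝ → ℝ} {a b t₀ : ℝ} (hg : ContinuousOn (Function.uncurry g) (Icc a b ×ˢ Ici t₀))
    {s : ℝ} (hs : t₀ ≤ s) : ContinuousOn (fun x => g x s) (Icc a b) :=
  hg.comp (f := fun x => (x, s)) (by fun_prop) (fun x hx => ⟨hx, hs⟩)

lemma ut_bdry {t x : ℝ} (ht : t₀ ≤ t) (hx : x ∈ Icc 0 π) (h : ∀ s ∈ Ici t₀, S.u x s = 0) :
    S.ut x t = 0 := by
  have h1 := S.hut x hx t ht
  have h2 : HasDerivWithinAt (fun s => S.u x s) 0 (Ici t₀) t :=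
    (hasDerivWithinAt_const t (Ici t₀) (0:ℝ)).congr (fun s hs => h s hs) (h t ht)
  exact (uniqueDiffOn_Ici t₀ t ht).eq_deriv _ h1 h2

lemma ut_green {t : ℝ} (ht : t₀ < t) : ∀ x ∈ Icc 0 π,
    S.ut x t = (∫ y in (0:ℝ)..x, (x - y) * S.uxxt y t)
      - (x / π) * ∫ y in (0:ℝ)..π, (π - y) * S.uxxt y t := by
  intro x hx
  have h1 := (S.hut x hx t ht.le).hasDerivAt (Ici_mem_nhds ht)
  have hD : ∀ b ∈ Icc 0 π, HasDerivAt (fun s => ∫ y in (0:ℝ)..b, (b - y) * S.uxx y s)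
      (∫ y in (0:ℝ)..b, (b - y) * S.uxxt y t) t := by
    intro b hb
    have hs : Icc 0 b ×ˢ Ici t₀ ⊆ Icc 0 π ×ˢ Ici t₀ := prod_mono_left (Icc_subset_Icc_right hb.2)
    apply diff_int (t₀ := t₀) (f := fun y s => (b - y) * S.uxx y s)
      (ft := fun y s => (b - y) * S.uxxt y s) hb.1 ht
    · exact (Continuous.continuousOn (by fun_prop : Continuous fun p : ℝ × ℝ => b - p.1)).mul
        (S.cont_uxx.mono hs)
    · exact (Continuous.continuousOn (by fun_prop : Continuous fun p : ℝ × ℝ => b - p.1)).mul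
        (S.cont_uxxt.mono hs)
    · intro y hy s hs'
      exact ((S.huxxt y ⟨hy.1, hy.2.trans hb.2⟩ s hs'.le).hasDerivAt (Ici_mem_nhds hs')).const_mul _
  have h2 := (hD x hx).sub ((hD π ⟨Real.pi_pos.le, le_rfl⟩).const_mul (x / π))
  refine h1.unique (h2.congr_of_eventuallyEq ?_)
  filter_upwards [Ioi_mem_nhds ht] with s hs
  have hs' : t₀ ≤ s := le_of_lt hs
  exact green (S.hux s hs') (S.huxx s hs') (csec S.cont_uxx hs')
    (S.bc0 s hs') (S.bcπ s hs') x hx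

lemma ut_x {t : ℝ} (ht : t₀ < t) : ∃ p : ℝ → ℝ,
    (∀ x ∈ Icc 0 π, HasDerivWithinAt (fun y => S.ut y t) (p x) (Icc 0 π) x) ∧
    (∀ x ∈ Icc 0 π, HasDerivWithinAt p (S.uxxt x t) (Icc 0 π) x) := by
  have hpi := Real.pi_pos.le
  set w : ℝ → ℝ := fun x => S.uxxt (projIcc 0 π hpi x) t with hw
  have hwc : Continuous w :=
    (csec S.cont_uxxt ht.le).comp_continuous (by fun_prop) (fun x => (projIcc 0 π hpi x).2)
  have hwe : ∀ x ∈ Icc 0 π, w x = S.uxxt x t := by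
    intro x hx; simp only [hw, projIcc_of_mem hpi hx]
  set J := ∫ y in (0:ℝ)..π, (π - y) * S.uxxt y t with hJ
  have hW : ∀ x, HasDerivAt (fun x => ∫ y in (0:ℝ)..x, w y) (w x) x := fun x =>
    intervalIntegral.integral_hasDerivAt_right (hwc.intervalIntegrable _ _)
      (hwc.stronglyMeasurableAtFilter _ _) hwc.continuousAt
  have hyc : Continuous (fun y => y * w y) := by fun_prop
  have hY : ∀ x, HasDerivAt (fun x => ∫ y in (0:ℝ)..x, y * w y) (x * w x) x := fun x =>
    intervalIntegral.integral_hasDerivAt_right (hyc.intervalIntegrable _ _)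
      (hyc.stronglyMeasurableAtFilter _ _) hyc.continuousAt
  have he : ∀ x ∈ Icc 0 π, S.ut x t =
      x * (∫ y in (0:ℝ)..x, w y) - (∫ y in (0:ℝ)..x, y * w y) - x * (J / π) := by
    intro x hx
    rw [ut_green S ht x hx, ← hJ, ← intervalIntegral.integral_const_mul x,
      ← intervalIntegral.integral_sub ((hwc.intervalIntegrable _ _).const_mul _)
        (hyc.intervalIntegrable _ _)]
    congr 1
    · apply intervalIntegral.integral_congr
      intro y hy
      rw [uIcc_of_le hx.1] at hy
      simp only [hwe y ⟨hy.1, hy.2.trans hx.2⟩]; ring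
    · ring
  refine ⟨fun x => (∫ y in (0:ℝ)..x, w y) - J / π, ?_, ?_⟩
  · intro x hx
    have h := (((hasDerivAt_id x).mul (hW x)).sub (hY x)).sub ((hasDerivAt_id x).mul_const (J / π))
    refine ((h.hasDerivWithinAt (s := Icc 0 π)).congr (fun y hy => he y hy) (he x hx)).congr_deriv ?_
    simp
  · intro x hx
    rw [← hwe x hx]
    exact ((hW x).sub_const _).hasDerivWithinAt

lemma I1 {t : ℝ} (ht : t₀ < t) :
    ∫ x in (0:ℝ)..π, (S.u x t * S.uxxt x t - S.ut x t * S.uxx x t) = 0 := by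
  obtain ⟨p, hp, hp'⟩ := ut_x S ht
  have hpc : ContinuousOn p (Icc 0 π) := fun x hx => (hp' x hx).continuousWithinAt
  have cu := csec S.cont_u ht.le
  have cux := csec S.cont_ux ht.le
  have cuxx := csec S.cont_uxx ht.le
  have cut := csec S.cont_ut ht.le
  have cw := csec S.cont_uxxt ht.le
  have h1 := by_parts (S.hux t ht.le) cux (S.bc0 t ht.le) (S.bcπ t ht.le) hp' cw
  have h2 := by_parts hp hpc (ut_bdry S ht.le ⟨le_rfl, Real.pi_pos.le⟩ S.bc0)
    (ut_bdry S ht.le ⟨Real.pi_pos.le, le_rfl⟩ S.bcπ) (S.huxx t ht.le) cuxx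
  have h3 := congrArg₂ (fun a b : ℝ => a - b) h1 h2
  simp only [sub_zero] at h3
  rw [← intervalIntegral.integral_sub (ii (by fun_prop)) (ii (by fun_prop))] at h3
  refine Eq.trans ?_ h3
  apply intervalIntegral.integral_congr
  intro x _
  ring

lemma I2 {t : ℝ} (ht : t₀ < t) :
    ∫ x in (0:ℝ)..π, (S.ut x t * S.uxxt x t + S.ut x t ^ 2) ≤ 0 := by
  obtain ⟨p, hp, hp'⟩ := ut_x S ht
  have hpc : ContinuousOn p (Icc 0 π) := fun x hx => (hp' x hx).continuousWithinAt
  have cut := csec S.cont_ut ht.le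
  have cw := csec S.cont_uxxt ht.le
  have b0 := ut_bdry S ht.le ⟨le_rfl, Real.pi_pos.le⟩ S.bc0
  have b1 := ut_bdry S ht.le ⟨Real.pi_pos.le, le_rfl⟩ S.bcπ
  have h1 := by_parts hp hpc b0 b1 hp' cw
  have h2 := wirtinger hp hpc b0 b1
  rw [intervalIntegral.integral_add (ii (by fun_prop)) (ii (by fun_prop))] at h1 ⊢
  simp only [← pow_two] at h1
  linarith

lemma I3 {t : ℝ} (ht : t₀ ≤ t) :
    ∫ x in (0:ℝ)..π, (S.u x t * S.uxx x t + S.ux x t ^ 2) = 0 := by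
  have h1 := by_parts (S.hux t ht) (csec S.cont_ux ht) (S.bc0 t ht) (S.bcπ t ht) (S.huxx t ht)
    (csec S.cont_uxx ht)
  simpa only [← pow_two] using h1

lemma I5 {t : ℝ} (ht : t₀ ≤ t) :
    ∫ x in (0:ℝ)..π, (S.u x t ^ 2 - S.ux x t ^ 2) ≤ 0 := by
  have cu := csec S.cont_u ht
  have cux := csec S.cont_ux ht
  have h1 := wirtinger (S.hux t ht) cux (S.bc0 t ht) (S.bcπ t ht)
  rw [intervalIntegral.integral_sub (ii (by fun_prop)) (ii (by fun_prop))]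
  linarith

lemma I4 {F' : ℝ → ℝ} {k t : ℝ} (hF : ∀ z, HasDerivAt F (F' z) z) (hF' : Continuous F')
    (hF0 : F 0 = 0) (hk : ∀ z, F' z ≤ k) (ht : t₀ ≤ t) :
    ∫ x in (0:ℝ)..π, (-F (S.u x t) * S.uxx x t - k * S.ux x t ^ 2) ≤ 0 := by
  have cu := csec S.cont_u ht
  have cux := csec S.cont_ux ht
  have cuxx := csec S.cont_uxx ht
  have hFc : Continuous F := continuous_iff_continuousAt.2 fun z => (hF z).continuousAt
  have h1 := by_parts (f := fun x => F (S.u x t)) (f' := fun x => F' (S.u x t) * S.ux x t)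
    (fun x hx => (hF _).comp_hasDerivWithinAt x (S.hux t ht x hx)) (by fun_prop)
    (by simp [S.bc0 t ht, hF0]) (by simp [S.bcπ t ht, hF0]) (S.huxx t ht) cuxx
  have h2 : ∫ x in (0:ℝ)..π, (-F (S.u x t) * S.uxx x t - k * S.ux x t ^ 2)
      ≤ ∫ x in (0:ℝ)..π, -(F (S.u x t) * S.uxx x t + F' (S.u x t) * S.ux x t * S.ux x t) := by
    apply intervalIntegral.integral_mono_on Real.pi_pos.le (ii (by fun_prop)) (ii (by fun_prop))
    intro x _
    nlinarith [mul_nonneg (sub_nonneg.2 (hk (S.u x t))) (sq_nonneg (S.ux x t))]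
  rw [intervalIntegral.integral_neg, h1] at h2
  linarith
end

lemma alg_deriv {u ux uxx v w vt e e1 e2 c c1 f k a ap γ θ μ A Cb eM M eb c0 η : ℝ}
    (pde : -e * w + vt - c * uxx + ap * v = f - a * v)
    (huf : u * f ≤ k * u ^ 2) (he : 0 ≤ e) (heM : e ≤ eM) (hk : 0 ≤ k) (hμ : 0 < μ)
    (hd : μ * (1 + e) ≤ c - e1) (hc : Cb ≤ c) (hmk : 0 ≤ μ + Cb / 2 - 2 * k)
    (ha : 0 ≤ a) (haA : a ≤ A) (he1 : e1 ≤ M) (hap : 0 ≤ ap) (he2 : eb ≤ e2)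
    (hc1 : c1 * (1 + γ) ≤ 1) (hθ : 0 ≤ θ)
    (hθ1 : eM * k + 1 / 2 - eb / 2 + ap * M / 2 + 1 ≤ θ * (Cb / 4))
    (hγ : 0 ≤ γ) (hγ1 : A * (1 / (2 * μ) + θ ^ 2) ≤ γ) (hγ2 : θ + 1 ≤ γ * c0) (hc0 : c0 ≤ ap + e)
    (hη1 : η ≤ μ / 2) (hη2 : η ≤ 1 / 4) :
    γ * v * vt + (e * uxx - v) * (e1 * uxx + e * w - vt)
      - (c1 * (1 + γ) - e2 + e1 * (ap + θ)) / 2 * (u * uxx)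
      - (c * (1 + γ) - e1 + e * (ap + θ)) / 2 * (v * uxx + u * w)
      + ap * θ * (u * v) + θ * (v ^ 2 + u * vt) - (1 + γ) * (f * v)
    ≤ γ * e * (v * w + v ^ 2)
      + (θ * e - (c * (1 + γ) - e1 + e * (ap + θ)) / 2) * (u * w - v * uxx)
      + e * (-f * uxx - k * ux ^ 2)
      + (θ * c - (c1 * (1 + γ) - e2 + e1 * (ap + θ)) / 2) * (u * uxx + ux ^ 2)
      + (θ * k + 1 / 2) * (u ^ 2 - ux ^ 2)
      - η * (e ^ 2 * uxx ^ 2 + ux ^ 2 + u ^ 2 + v ^ 2) := by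
  have hvt : vt = e * w + c * uxx - (ap + a) * v + f := by linarith
  subst hvt
  have hv2 := sq_nonneg v
  have hux2 := sq_nonneg ux
  -- the `u_x` coefficient
  have t1 : e * k + (c1 * (1 + γ) - e2 + e1 * (ap + θ)) / 2 - θ * c + θ * k + 1 / 2 ≤ -(1 / 2) := by
    have a1 : e * k ≤ eM * k := mul_le_mul_of_nonneg_right heM hk
    have a2 : ap * e1 ≤ ap * M := mul_le_mul_of_nonneg_left he1 hap
    have a3 : e1 / 2 - c + k ≤ - (Cb / 4) := by linarith [mul_nonneg hμ.le he]
    have a4 : θ * (e1 / 2 - c + k) ≤ θ * (- (Cb / 4)) := mul_le_mul_of_nonneg_left a3 hθ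
    linarith
  have t1' := mul_le_mul_of_nonneg_right t1 hux2
  -- the `u_xx` term
  have t2 : μ * (e * uxx) ^ 2 ≤ e * (c - e1) * uxx ^ 2 := by
    have : μ * e * e ≤ e * (c - e1) := by linarith [mul_le_mul_of_nonneg_left hd he, mul_nonneg hμ.le he]
    linarith [mul_le_mul_of_nonneg_right this (sq_nonneg uxx)]
  have t3 : a * v * (e * uxx) ≤ μ / 2 * (e * uxx) ^ 2 + a ^ 2 * v ^ 2 * (1 / (2 * μ)) := by
    have : 0 ≤ (μ * (e * uxx) - a * v) ^ 2 / (2 * μ) := by positivity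
    have e0 : (μ * (e * uxx) - a * v) ^ 2 / (2 * μ)
      = μ / 2 * (e * uxx) ^ 2 + a ^ 2 * v ^ 2 * (1 / (2 * μ)) - a * v * (e * uxx) := by
      field_simp; ring
    linarith
  have t4 : -(θ * a * u * v) ≤ 1 / 4 * u ^ 2 + θ ^ 2 * a ^ 2 * v ^ 2 := by
    linarith [sq_nonneg (1 / 2 * u + θ * a * v)]
  -- the `v` coefficient
  have t5 : -(γ * e) - (1 + γ) * (ap + a) + θ + a ^ 2 * (1 / (2 * μ) + θ ^ 2) ≤ -1 := by
    have b0 : 0 ≤ 1 / (2 * μ) + θ ^ 2 := by positivity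
    have b1 : a * (a * (1 / (2 * μ) + θ ^ 2)) ≤ a * γ :=
      mul_le_mul_of_nonneg_left ((mul_le_mul_of_nonneg_right haA b0).trans hγ1) ha
    have b2 : γ * c0 ≤ γ * (ap + e) := mul_le_mul_of_nonneg_left hc0 hγ
    clear t1 t1' t2 t3 t4 hθ1 hd hc hmk he2 hc1 huf pde
    generalize 1 / (2 * μ) + θ ^ 2 = ν at *
    linarith
  have t5' := mul_le_mul_of_nonneg_right t5 hv2
  have t6 := mul_le_mul_of_nonneg_left huf hθ
  have t7 := mul_le_mul_of_nonneg_right hη1 (sq_nonneg (e * uxx))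
  have t8 := mul_le_mul_of_nonneg_right hη2 hux2
  have t9 := mul_le_mul_of_nonneg_right hη2 (sq_nonneg u)
  have t10 := mul_le_mul_of_nonneg_right hη2 hv2
  generalize 1 / (2 * μ) = ν at *
  linarith

lemma alg_lower {u ux uxx v e e1 c p k ap γ θ μ Cb κ : ℝ}
    (hp : 2 * p ≤ k * u ^ 2) (he : 0 ≤ e) (hk : 0 ≤ k)  (hμ : 0 < μ) (hCb : 0 < Cb)
    (hkC : k ≤ Cb)
    (hd : μ * (1 + e) ≤ c - e1) (hc : Cb ≤ c) (hmk : 0 ≤ μ + Cb / 2 - 2 * k) (hap : 0 ≤ ap)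
    (hθ : 0 ≤ θ) (hγ : 8 * θ ^ 2 / Cb + 2 ≤ γ)
    (h1 : κ ≤ 1 / 2) (h2 : κ ≤ Cb / 8) :
    κ * (e ^ 2 * uxx ^ 2 + ux ^ 2 + u ^ 2 + v ^ 2)
      + (-(c * (1 + γ) - e1 + e * (ap + θ))) * (u * uxx + ux ^ 2)
      + (-((1 + γ) * k + Cb / 4)) * (u ^ 2 - ux ^ 2) ≤
    γ * v ^ 2 + (e * uxx - v) ^ 2 - (c * (1 + γ) - e1 + e * (ap + θ)) * (u * uxx)
      + ap * θ * u ^ 2 + 2 * θ * (u * v) - 2 * (1 + γ) * p := by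
  have hux2 := sq_nonneg ux
  have hγ0 : 2 ≤ γ := by
    have : 0 ≤ 8 * θ ^ 2 / Cb := by positivity
    linarith
  have t0 : 0 ≤ ap * θ * u ^ 2 := by positivity
  have t1 : Cb / 2 + (1 + γ) * k ≤ c * (1 + γ) - e1 + e * (ap + θ) := by
    have : 0 ≤ e * (ap + θ) := by positivity
    nlinarith [mul_nonneg (by linarith : (0:ℝ) ≤ γ - 1) (sub_nonneg.2 hkC),
      mul_nonneg (by linarith : (0:ℝ) ≤ γ) (sub_nonneg.2 hc), mul_nonneg hμ.le he]
  have t1' := mul_le_mul_of_nonneg_right t1 hux2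
  have t2 : -(2 * θ * (u * v)) ≤ Cb / 8 * u ^ 2 + 8 * θ ^ 2 / Cb * v ^ 2 := by
    have : 0 ≤ (Cb * u + 8 * θ * v) ^ 2 / (8 * Cb) := by positivity
    have e0 : (Cb * u + 8 * θ * v) ^ 2 / (8 * Cb)
      = Cb / 8 * u ^ 2 + 8 * θ ^ 2 / Cb * v ^ 2 + 2 * θ * (u * v) := by
      field_simp; ring
    linarith
  have t3 := mul_le_mul_of_nonneg_right hγ (sq_nonneg v)
  have t4 : 1 / 2 * (e * uxx) ^ 2 - v ^ 2 ≤ (e * uxx - v) ^ 2 := by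
    nlinarith [sq_nonneg (e * uxx - 2 * v)]
  have t5 := mul_le_mul_of_nonneg_right h1 (sq_nonneg (e * uxx))
  have t6 := mul_le_mul_of_nonneg_right h2 hux2
  have t7 := mul_le_mul_of_nonneg_right h2 (sq_nonneg u)
  have t8 := mul_le_mul_of_nonneg_right h1 (sq_nonneg v)
  have t9 := mul_le_mul_of_nonneg_left hp (by linarith : (0:ℝ) ≤ 1 + γ)
  generalize 8 * θ ^ 2 / Cb = ν at *
  have := mul_nonneg hCb.le hux2
  linarith [sq_nonneg v]

lemma alg_upper {u ux uxx v e e1 c p ap γ θ m eM M : ℝ}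
    (hp : -(2 * p) ≤ m * u ^ 2) (he : 0 ≤ e) (heM : e ≤ eM) (hM0 : 0 ≤ M) (hm : 0 ≤ m)
    (hc : c ≤ M) (he1 : -e1 ≤ M) (hap : 0 ≤ ap)
    (hθ : 0 ≤ θ) (hγ : 0 ≤ γ) :
    γ * v ^ 2 + (e * uxx - v) ^ 2 - (c * (1 + γ) - e1 + e * (ap + θ)) * (u * uxx)
      + ap * θ * u ^ 2 + 2 * θ * (u * v) - 2 * (1 + γ) * p ≤
    (1 + γ) * (2 + θ + 2 * M + eM * (ap + θ) + ap * θ + m) * 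
        (e ^ 2 * uxx ^ 2 + ux ^ 2 + u ^ 2 + v ^ 2)
      + (-(c * (1 + γ) - e1 + e * (ap + θ))) * (u * uxx + ux ^ 2) := by
  have heM0 : 0 ≤ eM := he.trans heM
  set G := 2 + θ + 2 * M + eM * (ap + θ) + ap * θ + m with hG
  have g0 : 0 ≤ eM * (ap + θ) := by positivity
  have g1 : 0 ≤ ap * θ := by positivity
  have t1 : c * (1 + γ) - e1 + e * (ap + θ) ≤ (1 + γ) * G := by
    have : e * (ap + θ) ≤ eM * (ap + θ) := mul_le_mul_of_nonneg_right heM (by positivity)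
    nlinarith [mul_le_mul_of_nonneg_right hc (by linarith : 0 ≤ 1 + γ),
      mul_nonneg hγ (by linarith : 0 ≤ G - M)]
  have t1' := mul_le_mul_of_nonneg_right t1 (sq_nonneg ux)
  have t2 : (e * uxx - v) ^ 2 ≤ 2 * (e * uxx) ^ 2 + 2 * v ^ 2 := by
    nlinarith [sq_nonneg (e * uxx + v)]
  have t3 : 2 * θ * (u * v) ≤ θ * u ^ 2 + θ * v ^ 2 := by
    nlinarith [mul_nonneg hθ (sq_nonneg (u - v))]
  have t4 := mul_le_mul_of_nonneg_left hp (by linarith : (0:ℝ) ≤ 1 + γ)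
  have t5 : γ + 2 + θ ≤ (1 + γ) * G := by
    nlinarith [mul_nonneg hγ (by linarith : 0 ≤ G - 1)]
  have t6 : ap * θ + θ + (1 + γ) * m ≤ (1 + γ) * G := by
    nlinarith [mul_nonneg hγ (by linarith : 0 ≤ G - m)]
  have t7 : 2 ≤ (1 + γ) * G := by
    nlinarith [mul_nonneg hγ (by linarith : 0 ≤ G)]
  have t5' := mul_le_mul_of_nonneg_right t5 (sq_nonneg v)
  have t6' := mul_le_mul_of_nonneg_right t6 (sq_nonneg u)
  have t7' := mul_le_mul_of_nonneg_right t7 (sq_nonneg (e * uxx))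
  linarith

lemma F_sign {F F' : ℝ → ℝ} {k : ℝ} (hF : ∀ z, HasDerivAt F (F' z) z)
    (hF0 : F 0 = 0) (hk : ∀ z, F' z ≤ k) (z : ℝ) : z * F z ≤ k * z ^ 2 := by
  have hG : ∀ x, HasDerivAt (fun x => k * x - F x) (k - F' x) x := fun x =>
    (((hasDerivAt_id x).const_mul k).sub (hF x)).congr_deriv (by simp)
  have hm : Monotone (fun x => k * x - F x) :=
    monotone_of_hasDerivAt_nonneg hG (fun x => sub_nonneg.2 (hk x))
  rcases le_total 0 z with h | h
  · have := hm h; simp only [hF0] at this; nlinarith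
  · have := hm h; simp only [hF0] at this; nlinarith

lemma prim_le {F : ℝ → ℝ} {k R : ℝ} (hF : Continuous F)
    (h : ∀ z, |z| ≤ R → z * F z ≤ k * z ^ 2) (z : ℝ) (hz : |z| ≤ R) :
    2 * ∫ y in (0:ℝ)..z, F y ≤ k * z ^ 2 := by
  have hk : ∀ a b : ℝ, ∫ y in a..b, k * y = k * ((b ^ 2 - a ^ 2) / 2) := by
    intro a b; rw [intervalIntegral.integral_const_mul, integral_id]
  have hi := fun a b => hF.intervalIntegrable (μ := volume) a b
  have hi2 := fun a b => (by fun_prop : Continuous fun y : ℝ => k * y).intervalIntegrable (μ := volume) a b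
  rcases le_total 0 z with h0 | h0
  · have : ∫ y in (0:ℝ)..z, F y ≤ ∫ y in (0:ℝ)..z, k * y := by
      apply intervalIntegral.integral_mono_on_of_le_Ioo h0 (hi _ _) (hi2 _ _)
      intro y hy
      have := h y (by rw [abs_of_pos hy.1]; rw [abs_of_nonneg h0] at hz; linarith [hy.2])
      have hy1 := hy.1
      nlinarith
    rw [hk] at this; linarith
  · have : ∫ y in z..0, k * y ≤ ∫ y in z..0, F y := by
      apply intervalIntegral.integral_mono_on_of_le_Ioo h0 (hi2 _ _) (hi _ _)
      intro y hy
      have := h y (by rw [abs_of_neg hy.2]; rw [abs_of_nonpos h0] at hz; linarith [hy.1])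
      have hy1 := hy.2
      nlinarith
    rw [hk] at this; rw [intervalIntegral.integral_symm]; linarith

lemma F_lip {F F' : ℝ → ℝ} (hF : ∀ z, HasDerivAt F (F' z) z) (hF' : Continuous F')
    (hF0 : F 0 = 0) (R : ℝ) : ∃ m, 0 ≤ m ∧ ∀ z, |z| ≤ R → -(z * F z) ≤ m * z ^ 2 := by
  obtain ⟨m, hm⟩ := (isCompact_Icc (a := -R) (b := R)).exists_bound_of_continuousOn hF'.continuousOn
  refine ⟨max m 0, le_max_right _ _, fun z hz => ?_⟩
  have hR := (abs_nonneg z).trans hz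
  have := (convex_Icc (-R) R).norm_image_sub_le_of_norm_hasDerivWithin_le
    (fun x _ => (hF x).hasDerivWithinAt) hm (x := 0) (y := z) ⟨by linarith, hR⟩ (abs_le.1 hz)
  rw [hF0, sub_zero, sub_zero, Real.norm_eq_abs, Real.norm_eq_abs] at this
  have h2 : |z * F z| ≤ m * z ^ 2 := by
    rw [abs_mul, ← sq_abs]; nlinarith [abs_nonneg z]
  have := neg_abs_le (z * F z)
  nlinarith [le_max_left m 0, sq_nonneg z]

section
variable {ε C F : ℝ → ℝ} {a' t₀ : ℝ} (S : ClassicalSolution ε C F a' t₀)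

/-- Integrand of the Liapunov functional. -/
noncomputable def phi (ε' : ℝ → ℝ) (γ θ x t : ℝ) : ℝ :=
  γ * S.ut x t ^ 2 + (ε t * S.uxx x t - S.ut x t) ^ 2
    - (C t * (1 + γ) - ε' t + ε t * (a' + θ)) * (S.u x t * S.uxx x t)
    + a' * θ * S.u x t ^ 2 + 2 * θ * (S.u x t * S.ut x t)
    - 2 * (1 + γ) * ∫ y in (0:ℝ)..(S.u x t), F y

/-- Half of the time derivative of the integrand. -/
noncomputable def phit (ε' ε'' C' : ℝ → ℝ) (γ θ x t : ℝ) : ℝ :=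
  γ * S.ut x t * S.utt x t
    + (ε t * S.uxx x t - S.ut x t) * (ε' t * S.uxx x t + ε t * S.uxxt x t - S.utt x t)
    - (C' t * (1 + γ) - ε'' t + ε' t * (a' + θ)) / 2 * (S.u x t * S.uxx x t)
    - (C t * (1 + γ) - ε' t + ε t * (a' + θ)) / 2 * (S.ut x t * S.uxx x t + S.u x t * S.uxxt x t)
    + a' * θ * (S.u x t * S.ut x t) + θ * (S.ut x t ^ 2 + S.u x t * S.utt x t)
    - (1 + γ) * (F (S.u x t) * S.ut x t)

/-- Integrand of `d(t)^2`. -/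
noncomputable def dens (x t : ℝ) : ℝ :=
  (ε t)^2 * (S.uxx x t)^2 + (S.ux x t)^2 + (S.u x t)^2 + (S.ut x t)^2

lemma csnd {g : ℝ → ℝ} (hg : ContinuousOn g (Ici 0)) (h0 : 0 ≤ t₀) :
    ContinuousOn (fun p : ℝ × ℝ => g p.2) (Icc 0 π ×ˢ Ici t₀) :=
  hg.comp continuousOn_snd (fun p hp => le_trans h0 hp.2)

lemma prim_deriv (hF : Continuous F) (z : ℝ) :
    HasDerivAt (fun z => ∫ y in (0:ℝ)..z, F y) (F z) z :=
  intervalIntegral.integral_hasDerivAt_right (hF.intervalIntegrable _ _)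
    (hF.stronglyMeasurableAtFilter _ _) hF.continuousAt

lemma prim_cont (hF : Continuous F) : Continuous (fun z => ∫ y in (0:ℝ)..z, F y) :=
  continuous_iff_continuousAt.2 fun z => (prim_deriv hF z).continuousAt

lemma aux_phi {s : Set (ℝ × ℝ)} {u uxx ut e e' c P : ℝ × ℝ → ℝ} (a γ θ : ℝ)
    (h1 : ContinuousOn u s) (h2 : ContinuousOn uxx s) (h3 : ContinuousOn ut s)
    (h4 : ContinuousOn e s) (h5 : ContinuousOn e' s) (h6 : ContinuousOn c s)
    (h8 : ContinuousOn P s) :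
    ContinuousOn (fun p => γ * ut p ^ 2 + (e p * uxx p - ut p) ^ 2
    - (c p * (1 + γ) - e' p + e p * (a + θ)) * (u p * uxx p)
    + a * θ * u p ^ 2 + 2 * θ * (u p * ut p)
    - 2 * (1 + γ) * P p) s := by fun_prop

lemma aux_phit {s : Set (ℝ × ℝ)} {u uxx ut utt uxxt e e' e'' c c' P : ℝ × ℝ → ℝ} (a γ θ : ℝ)
    (h1 : ContinuousOn u s) (h2 : ContinuousOn uxx s) (h3 : ContinuousOn ut s)
    (h9 : ContinuousOn utt s) (h10 : ContinuousOn uxxt s)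
    (h4 : ContinuousOn e s) (h5 : ContinuousOn e' s) (h6 : ContinuousOn c s)
    (h7 : ContinuousOn e'' s) (h8 : ContinuousOn c' s) (h11 : ContinuousOn P s) :
    ContinuousOn (fun p => γ * ut p * utt p
    + (e p * uxx p - ut p) * (e' p * uxx p + e p * uxxt p - utt p)
    - (c' p * (1 + γ) - e'' p + e' p * (a + θ)) / 2 * (u p * uxx p)
    - (c p * (1 + γ) - e' p + e p * (a + θ)) / 2 * (ut p * uxx p + u p * uxxt p)
    + a * θ * (u p * ut p) + θ * (ut p ^ 2 + u p * utt p)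
    - (1 + γ) * (P p * ut p)) s := by fun_prop

lemma aux_dens {s : Set (ℝ × ℝ)} {u ux uxx ut e : ℝ × ℝ → ℝ}
    (h1 : ContinuousOn u s) (h2 : ContinuousOn uxx s) (h3 : ContinuousOn ut s)
    (h4 : ContinuousOn e s) (h5 : ContinuousOn ux s) :
    ContinuousOn (fun p => (e p)^2 * (uxx p)^2 + (ux p)^2 + (u p)^2 + (ut p)^2) s := by fun_prop

lemma phi_cont {ε' : ℝ → ℝ} (h0 : 0 ≤ t₀) (hF : Continuous F) (hε : ContinuousOn ε (Ici 0))
    (hε' : ContinuousOn ε' (Ici 0)) (hC : ContinuousOn C (Ici 0)) (γ θ : ℝ) :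
    ContinuousOn (Function.uncurry (phi S ε' γ θ)) (Icc 0 π ×ˢ Ici t₀) := by
  have h1 : ContinuousOn (fun p : ℝ × ℝ => S.u p.1 p.2) (Icc 0 π ×ˢ Ici t₀) := S.cont_u
  have h2 : ContinuousOn (fun p : ℝ × ℝ => S.uxx p.1 p.2) (Icc 0 π ×ˢ Ici t₀) := S.cont_uxx
  have h3 : ContinuousOn (fun p : ℝ × ℝ => S.ut p.1 p.2) (Icc 0 π ×ˢ Ici t₀) := S.cont_ut
  have h4 := csnd (t₀ := t₀) hε h0
  have h5 := csnd (t₀ := t₀) hε' h0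
  have h6 := csnd (t₀ := t₀) hC h0
  have h7 := (prim_cont hF).comp_continuousOn h1
  have h8 : ContinuousOn (fun p : ℝ × ℝ => ∫ y in (0:ℝ)..(S.u p.1 p.2), F y)
    (Icc 0 π ×ˢ Ici t₀) := h7
  change ContinuousOn (fun p : ℝ × ℝ => phi S ε' γ θ p.1 p.2) _
  exact aux_phi a' γ θ h1 h2 h3 h4 h5 h6 h8

lemma phit_cont {ε' ε'' C' : ℝ → ℝ} (h0 : 0 ≤ t₀) (hF : Continuous F) (hε : ContinuousOn ε (Ici 0))
    (hε' : ContinuousOn ε' (Ici 0)) (hε'' : ContinuousOn ε'' (Ici 0)) (hC : ContinuousOn C (Ici 0))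
    (hC' : ContinuousOn C' (Ici 0)) (γ θ : ℝ) :
    ContinuousOn (Function.uncurry (phit S ε' ε'' C' γ θ)) (Icc 0 π ×ˢ Ici t₀) := by
  have h1 : ContinuousOn (fun p : ℝ × ℝ => S.u p.1 p.2) (Icc 0 π ×ˢ Ici t₀) := S.cont_u
  have h2 : ContinuousOn (fun p : ℝ × ℝ => S.uxx p.1 p.2) (Icc 0 π ×ˢ Ici t₀) := S.cont_uxx
  have h3 : ContinuousOn (fun p : ℝ × ℝ => S.ut p.1 p.2) (Icc 0 π ×ˢ Ici t₀) := S.cont_ut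
  have h9 : ContinuousOn (fun p : ℝ × ℝ => S.utt p.1 p.2) (Icc 0 π ×ˢ Ici t₀) := S.cont_utt
  have h10 : ContinuousOn (fun p : ℝ × ℝ => S.uxxt p.1 p.2) (Icc 0 π ×ˢ Ici t₀) := S.cont_uxxt
  have h4 := csnd (t₀ := t₀) hε h0
  have h5 := csnd (t₀ := t₀) hε' h0
  have h6 := csnd (t₀ := t₀) hC h0
  have h7 := csnd (t₀ := t₀) hε'' h0
  have h8 := csnd (t₀ := t₀) hC' h0
  change ContinuousOn (fun p : ℝ × ℝ => phit S ε' ε'' C' γ θ p.1 p.2) _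
  exact aux_phit a' γ θ h1 h2 h3 h9 h10 h4 h5 h6 h7 h8 (hF.comp_continuousOn h1)

lemma dens_cont (h0 : 0 ≤ t₀) (hε : ContinuousOn ε (Ici 0)) :
    ContinuousOn (Function.uncurry (dens S)) (Icc 0 π ×ˢ Ici t₀) := by
  have h1 : ContinuousOn (fun p : ℝ × ℝ => S.u p.1 p.2) (Icc 0 π ×ˢ Ici t₀) := S.cont_u
  have h2 : ContinuousOn (fun p : ℝ × ℝ => S.uxx p.1 p.2) (Icc 0 π ×ˢ Ici t₀) := S.cont_uxx
  have h3 : ContinuousOn (fun p : ℝ × ℝ => S.ut p.1 p.2) (Icc 0 π ×ˢ Ici t₀) := S.cont_ut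
  have h5 : ContinuousOn (fun p : ℝ × ℝ => S.ux p.1 p.2) (Icc 0 π ×ˢ Ici t₀) := S.cont_ux
  have h4 := csnd (t₀ := t₀) hε h0
  change ContinuousOn (fun p : ℝ × ℝ => dens S p.1 p.2) _
  exact aux_dens h1 h2 h3 h4 h5

lemma energy_deriv {ε' ε'' C' : ℝ → ℝ} (h0 : 0 ≤ t₀) (hF : Continuous F)
    (hε : ∀ t ∈ Ici (0:ℝ), HasDerivWithinAt ε (ε' t) (Ici 0) t)
    (hε' : ∀ t ∈ Ici (0:ℝ), HasDerivWithinAt ε' (ε'' t) (Ici 0) t)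
    (hε'' : ContinuousOn ε'' (Ici 0))
    (hC : ∀ t ∈ Ici (0:ℝ), HasDerivWithinAt C (C' t) (Ici 0) t)
    (hC' : ContinuousOn C' (Ici 0)) (γ θ : ℝ) {t : ℝ} (ht : t₀ < t) :
    HasDerivAt (fun s => ∫ x in (0:ℝ)..π, phi S ε' γ θ x s)
      (2 * ∫ x in (0:ℝ)..π, phit S ε' ε'' C' γ θ x t) t := by
  have cε : ContinuousOn ε (Ici 0) := fun t ht => (hε t ht).continuousWithinAt
  have cε' : ContinuousOn ε' (Ici 0) := fun t ht => (hε' t ht).continuousWithinAt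
  have cC : ContinuousOn C (Ici 0) := fun t ht => (hC t ht).continuousWithinAt
  rw [← intervalIntegral.integral_const_mul]
  refine diff_int (t₀ := t₀) (f := phi S ε' γ θ)
    (ft := fun x s => 2 * phit S ε' ε'' C' γ θ x s) Real.pi_pos.le ht
    (phi_cont S h0 hF cε cε' cC γ θ) ?_ ?_
  · exact continuousOn_const.mul (phit_cont S h0 hF cε cε' hε'' cC hC' γ θ)
  · intro x hx s hs
    have hs0 : 0 < s := h0.trans_lt hs
    have du := (S.hut x hx s hs.le).hasDerivAt (Ici_mem_nhds hs)
    have dut := (S.hutt x hx s hs.le).hasDerivAt (Ici_mem_nhds hs)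
    have duxx := (S.huxxt x hx s hs.le).hasDerivAt (Ici_mem_nhds hs)
    have dε := (hε s hs0.le).hasDerivAt (Ici_mem_nhds hs0)
    have dε' := (hε' s hs0.le).hasDerivAt (Ici_mem_nhds hs0)
    have dC := (hC s hs0.le).hasDerivAt (Ici_mem_nhds hs0)
    have dP : HasDerivAt (fun r => ∫ y in (0:ℝ)..(S.u x r), F y) (F (S.u x s) * S.ut x s) s :=
      (prim_deriv hF (S.u x s)).comp s du
    have key := (((((((dut.pow 2).const_mul γ).add (((dε.mul duxx).sub dut).pow 2)).sub
      ((((dC.mul_const (1 + γ)).sub dε').add (dε.mul_const (a' + θ))).mul (du.mul duxx))).add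
      ((du.pow 2).const_mul (a' * θ))).add ((du.mul dut).const_mul (2 * θ))).sub
      (dP.const_mul (2 * (1 + γ))))
    refine HasDerivAt.congr_deriv (f := fun r => phi S ε' γ θ x r) key ?_
    unfold phit
    simp
    ring

lemma d_sq (t : ℝ) : S.d t ^ 2 = ∫ x in (0:ℝ)..π, dens S x t := by
  unfold ClassicalSolution.d
  rw [Real.sq_sqrt]
  · rfl
  · apply intervalIntegral.integral_nonneg Real.pi_pos.le
    intro x _; positivity

lemma d_nonneg (t : ℝ) : 0 ≤ S.d t := Real.sqrt_nonneg _

lemma d_cont (h0 : 0 ≤ t₀) (hε : ContinuousOn ε (Ici 0)) : ContinuousOn S.d (Ici t₀) :=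
  (cont_int Real.pi_pos.le (dens_cont S h0 hε)).sqrt

lemma sup_bound (h0 : 0 ≤ t₀) (hε : ContinuousOn ε (Ici 0)) {t x : ℝ} (ht : t₀ ≤ t)
    (hx : x ∈ Icc 0 π) : |S.u x t| ≤ π / 2 + S.d t ^ 2 / 2 := by
  have hs : Icc 0 x ⊆ Icc 0 π := Icc_subset_Icc_right hx.2
  have cux := csec S.cont_ux ht
  have cd : ContinuousOn (fun x => dens S x t) (Icc 0 π) := csec (dens_cont S h0 hε) ht
  have h1 := ftc_icc (f := fun y => S.u y t) (f' := fun y => S.ux y t) hx.1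
    (fun y hy => (S.hux t ht y (hs hy)).mono hs) (cux.mono hs)
  rw [S.bc0 t ht, sub_zero] at h1
  rw [← h1]
  refine (intervalIntegral.abs_integral_le_integral_abs hx.1).trans ?_
  have h2 : ∫ y in (0:ℝ)..x, |S.ux y t| ≤ ∫ y in (0:ℝ)..π, |S.ux y t| := by
    apply intervalIntegral.integral_mono_interval le_rfl hx.1 hx.2
    · exact Eventually.of_forall fun y => abs_nonneg _
    · exact ii cux.abs
  refine h2.trans ?_
  have h3 : ∫ y in (0:ℝ)..π, |S.ux y t| ≤ ∫ y in (0:ℝ)..π, (1 / 2 + 1 / 2 * dens S y t) := by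
    apply intervalIntegral.integral_mono_on Real.pi_pos.le (ii cux.abs) (ii (by fun_prop))
    intro y _
    have : S.ux y t ^ 2 ≤ dens S y t := by
      unfold dens
      nlinarith [sq_nonneg (ε t * S.uxx y t), sq_nonneg (S.u y t), sq_nonneg (S.ut y t)]
    rw [← sq_abs] at this
    nlinarith [sq_nonneg (|S.ux y t| - 1)]
  rw [intervalIntegral.integral_add (ii (by fun_prop)) (ii (by fun_prop)),
    intervalIntegral.integral_const_mul, ← d_sq] at h3
  simp only [intervalIntegral.integral_const, smul_eq_mul] at h3
  linarith

lemma energy_dissip {ε' ε'' C' F' : ℝ → ℝ} (h0 : 0 ≤ t₀)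
    (hFd : ∀ z, HasDerivAt F (F' z) z) (hF' : Continuous F') (hF0 : F 0 = 0)
    (cε : ContinuousOn ε (Ici 0)) (cε' : ContinuousOn ε' (Ici 0))
    (cε'' : ContinuousOn ε'' (Ici 0)) (cC : ContinuousOn C (Ici 0))
    (cC' : ContinuousOn C' (Ici 0))
    {γ θ t k μ A Cb eM M eb c0 η : ℝ} (ht : t₀ < t) (hFk : ∀ z, F' z ≤ k)
    (he : 0 ≤ ε t) (heM : ε t ≤ eM) (hk : 0 ≤ k) (hμ : 0 < μ)
    (hd : μ * (1 + ε t) ≤ C t - ε' t) (hc : Cb ≤ C t) (hmk : 0 ≤ μ + Cb / 2 - 2 * k)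
    (haA : ∀ x ∈ Icc (0:ℝ) π, S.aa x t ≤ A) (he1 : ε' t ≤ M) (hap : 0 ≤ a') (he2 : eb ≤ ε'' t)
    (hc1 : C' t * (1 + γ) ≤ 1) (hθ : 0 ≤ θ)
    (hθ1 : eM * k + 1 / 2 - eb / 2 + a' * M / 2 + 1 ≤ θ * (Cb / 4))
    (hγ : 0 ≤ γ) (hγ1 : A * (1 / (2 * μ) + θ ^ 2) ≤ γ) (hγ2 : θ + 1 ≤ γ * c0)
    (hc0 : c0 ≤ a' + ε t) (hη1 : η ≤ μ / 2) (hη2 : η ≤ 1 / 4) :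
    ∫ x in (0:ℝ)..π, phit S ε' ε'' C' γ θ x t ≤ - η * S.d t ^ 2 := by
  have hFc : Continuous F := continuous_iff_continuousAt.2 fun z => (hFd z).continuousAt
  have cu := csec S.cont_u ht.le
  have cux := csec S.cont_ux ht.le
  have cuxx := csec S.cont_uxx ht.le
  have cut := csec S.cont_ut ht.le
  have cw := csec S.cont_uxxt ht.le
  have cd : ContinuousOn (fun x => dens S x t) (Icc 0 π) := csec (dens_cont S h0 cε) ht.le
  have cp : ContinuousOn (fun x => phit S ε' ε'' C' γ θ x t) (Icc 0 π) :=
    csec (phit_cont S h0 hFc cε cε' cε'' cC cC' γ θ) ht.le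
  have i1 := I1 S ht
  have i2 := I2 S ht
  have i3 := I3 S ht.le
  have i4 := I4 S hFd hF' hF0 hFk ht.le
  have i5 := I5 S ht.le
  have key : ∫ x in (0:ℝ)..π, phit S ε' ε'' C' γ θ x t ≤ ∫ x in (0:ℝ)..π,
     (γ * ε t * (S.ut x t * S.uxxt x t + S.ut x t ^ 2)
      + (θ * ε t - (C t * (1 + γ) - ε' t + ε t * (a' + θ)) / 2)
        * (S.u x t * S.uxxt x t - S.ut x t * S.uxx x t)
      + ε t * (-F (S.u x t) * S.uxx x t - k * S.ux x t ^ 2)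
      + (θ * C t - (C' t * (1 + γ) - ε'' t + ε' t * (a' + θ)) / 2)
        * (S.u x t * S.uxx x t + S.ux x t ^ 2)
      + (θ * k + 1 / 2) * (S.u x t ^ 2 - S.ux x t ^ 2)
      - η * dens S x t) := by
    apply intervalIntegral.integral_mono_on_of_le_Ioo Real.pi_pos.le (ii cp) (ii (by fun_prop))
    intro x hx
    have hx' := Ioo_subset_Icc_self hx
    exact alg_deriv (S.pde x hx t ht) (F_sign hFd hF0 hFk _) he heM hk hμ hd hc hmk
      (S.aa_nonneg x hx' t ht.le) (haA x hx') he1 hap he2 hc1 hθ hθ1 hγ hγ1 hγ2 hc0 hη1 hη2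
  rw [intervalIntegral.integral_sub (ii (by fun_prop)) (ii (by fun_prop)),
    intervalIntegral.integral_add (ii (by fun_prop)) (ii (by fun_prop)),
    intervalIntegral.integral_add (ii (by fun_prop)) (ii (by fun_prop)),
    intervalIntegral.integral_add (ii (by fun_prop)) (ii (by fun_prop)),
    intervalIntegral.integral_add (ii (by fun_prop)) (ii (by fun_prop))] at key
  simp only [intervalIntegral.integral_const_mul] at key
  rw [i1, i3, ← d_sq] at key
  have j2 := mul_nonpos_of_nonneg_of_nonpos (mul_nonneg hγ he) i2
  have j4 := mul_nonpos_of_nonneg_of_nonpos he i4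
  have j5 := mul_nonpos_of_nonneg_of_nonpos (by positivity : 0 ≤ θ * k + 1 / 2) i5
  linarith

lemma energy_lower {ε' F' : ℝ → ℝ} (h0 : 0 ≤ t₀)
    (hFd : ∀ z, HasDerivAt F (F' z) z) (hF0 : F 0 = 0)
    (cε : ContinuousOn ε (Ici 0)) (cε' : ContinuousOn ε' (Ici 0)) (cC : ContinuousOn C (Ici 0))
    {γ θ t k μ Cb κ : ℝ} (ht : t₀ ≤ t) (hFk : ∀ z, F' z ≤ k)
    (he : 0 ≤ ε t) (hk : 0 ≤ k)  (hμ : 0 < μ) (hCb : 0 < Cb)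
    (hkC : k ≤ Cb)
    (hd : μ * (1 + ε t) ≤ C t - ε' t) (hc : Cb ≤ C t) (hmk : 0 ≤ μ + Cb / 2 - 2 * k)
    (hap : 0 ≤ a') (hθ : 0 ≤ θ) (hγ : 8 * θ ^ 2 / Cb + 2 ≤ γ)
    (h1 : κ ≤ 1 / 2) (h2 : κ ≤ Cb / 8) :
    κ * S.d t ^ 2 ≤ ∫ x in (0:ℝ)..π, phi S ε' γ θ x t := by
  have hFc : Continuous F := continuous_iff_continuousAt.2 fun z => (hFd z).continuousAt
  have cu := csec S.cont_u ht
  have cux := csec S.cont_ux ht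
  have cuxx := csec S.cont_uxx ht
  have cd : ContinuousOn (fun x => dens S x t) (Icc 0 π) := csec (dens_cont S h0 cε) ht
  have cp : ContinuousOn (fun x => phi S ε' γ θ x t) (Icc 0 π) :=
    csec (phi_cont S h0 hFc cε cε' cC γ θ) ht
  have i3 := I3 S ht
  have i5 := I5 S ht
  have key : ∫ x in (0:ℝ)..π, (κ * dens S x t
      + (-(C t * (1 + γ) - ε' t + ε t * (a' + θ))) * (S.u x t * S.uxx x t + S.ux x t ^ 2)
      + (-((1 + γ) * k + Cb / 4)) * (S.u x t ^ 2 - S.ux x t ^ 2)) ≤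
      ∫ x in (0:ℝ)..π, phi S ε' γ θ x t := by
    apply intervalIntegral.integral_mono_on Real.pi_pos.le (ii (by fun_prop)) (ii cp)
    intro x hx
    exact alg_lower (prim_le hFc (fun z _ => F_sign hFd hF0 hFk z) _ le_rfl) he hk hμ hCb hkC hd hc
      hmk hap hθ hγ h1 h2
  rw [intervalIntegral.integral_add (ii (by fun_prop)) (ii (by fun_prop)),
    intervalIntegral.integral_add (ii (by fun_prop)) (ii (by fun_prop))] at key
  simp only [intervalIntegral.integral_const_mul] at key
  rw [i3, ← d_sq] at key
  have hγ0 : 0 ≤ γ := by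
    have : 0 ≤ 8 * θ ^ 2 / Cb := by positivity
    linarith
  have j5 := mul_nonpos_of_nonneg_of_nonpos (by positivity : 0 ≤ (1 + γ) * k + Cb / 4) i5
  linarith

lemma energy_upper {ε' : ℝ → ℝ} (h0 : 0 ≤ t₀) (hFc : Continuous F)
    (cε : ContinuousOn ε (Ici 0)) (cε' : ContinuousOn ε' (Ici 0)) (cC : ContinuousOn C (Ici 0))
    {γ θ t m eM M R : ℝ} (ht : t₀ ≤ t) (hm : 0 ≤ m)
    (hR : ∀ z, |z| ≤ π / 2 + R ^ 2 / 2 → -(z * F z) ≤ m * z ^ 2) (hdR : S.d t ≤ R)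
    (he : 0 ≤ ε t) (heM : ε t ≤ eM) (hM0 : 0 ≤ M)
    (hc : C t ≤ M) (he1 : -ε' t ≤ M) (hap : 0 ≤ a') (hθ : 0 ≤ θ) (hγ : 0 ≤ γ) :
    ∫ x in (0:ℝ)..π, phi S ε' γ θ x t ≤
      (1 + γ) * (2 + θ + 2 * M + eM * (a' + θ) + a' * θ + m) * S.d t ^ 2 := by
  have cu := csec S.cont_u ht
  have cux := csec S.cont_ux ht
  have cuxx := csec S.cont_uxx ht
  have cd : ContinuousOn (fun x => dens S x t) (Icc 0 π) := csec (dens_cont S h0 cε) ht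
  have cp : ContinuousOn (fun x => phi S ε' γ θ x t) (Icc 0 π) :=
    csec (phi_cont S h0 hFc cε cε' cC γ θ) ht
  have i3 := I3 S ht
  have key : ∫ x in (0:ℝ)..π, phi S ε' γ θ x t ≤
    ∫ x in (0:ℝ)..π, ((1 + γ) * (2 + θ + 2 * M + eM * (a' + θ) + a' * θ + m) * dens S x t
      + (-(C t * (1 + γ) - ε' t + ε t * (a' + θ))) * (S.u x t * S.uxx x t + S.ux x t ^ 2)) := by
    apply intervalIntegral.integral_mono_on Real.pi_pos.le (ii cp) (ii (by fun_prop))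
    intro x hx
    refine alg_upper ?_ he heM hM0 hm hc he1 hap hθ hγ
    have hb := sup_bound S h0 cε ht hx
    have hb2 : S.d t ^ 2 ≤ R ^ 2 := pow_le_pow_left₀ (d_nonneg S t) hdR 2
    have := prim_le (F := fun z => -F z) (k := m) hFc.neg
      (fun z hz => by simpa using hR z hz) (S.u x t) (by linarith)
    rw [intervalIntegral.integral_neg] at this
    linarith
  rw [intervalIntegral.integral_add (ii (by fun_prop)) (ii (by fun_prop))] at key
  simp only [intervalIntegral.integral_const_mul] at key
  rw [i3, ← d_sq] at key
  linarith
end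

lemma abstract_decay {d L L' : ℝ → ℝ} {t₀ κ η B σ : ℝ} (dc : ContinuousOn d (Ici t₀))
    (Lc : ContinuousOn L (Ici t₀)) (d0 : ∀ t, 0 ≤ d t)
    (hL : ∀ t, t₀ < t → HasDerivAt L (2 * L' t) t)
    (hdis : ∀ t, t₀ < t → d t ≤ σ → L' t ≤ -η * d t ^ 2)
    (low : ∀ t, t₀ ≤ t → κ * d t ^ 2 ≤ L t)
    (up : ∀ t, t₀ ≤ t → d t ≤ σ → L t ≤ B * d t ^ 2)
    (h0 : d t₀ < σ) (h1 : L t₀ < κ * σ ^ 2) (hκ : 0 < κ) (hη : 0 < η) (hB : 0 < B) :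
    ∀ t, t₀ ≤ t → d t ≤ Real.sqrt (B / κ) * Real.exp (-(η / B) * (t - t₀)) * d t₀ := by
  have hσ : 0 ≤ σ := (d0 t₀).trans h0.le
  have bd : ∀ t, t₀ ≤ t → d t ≤ σ := by
    by_contra! hcon
    obtain ⟨T, hT, hdT⟩ := hcon
    -- first time
    set Z : Set ℝ := Icc t₀ T ∩ d ⁻¹' (Ici σ) with hZ
    have hZc : IsCompact Z := by
      apply isCompact_Icc.of_isClosed_subset _ inter_subset_left
      exact (dc.mono Icc_subset_Ici_self).preimage_isClosed_of_isClosed isClosed_Icc isClosed_Ici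
    have hZn : Z.Nonempty := ⟨T, ⟨hT, le_rfl⟩, hdT.le⟩
    obtain ⟨t1, ht1, hmin⟩ := hZc.exists_isLeast hZn
    have hlt : ∀ t, t₀ ≤ t → t < t1 → d t ≤ σ := by
      intro t h h'
      by_contra! hh
      exact absurd (hmin ⟨⟨h, h'.le.trans ht1.1.2⟩, hh.le⟩) (not_le.2 h')
    have hanti : AntitoneOn L (Icc t₀ t1) := by
      apply antitoneOn_of_deriv_nonpos (convex_Icc _ _) (Lc.mono Icc_subset_Ici_self)
      · intro t ht
        rw [interior_Icc] at ht
        exact (hL t ht.1).differentiableAt.differentiableWithinAt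
      · intro t ht
        rw [interior_Icc] at ht
        rw [(hL t ht.1).deriv]
        have := hdis t ht.1 (hlt t ht.1.le ht.2)
        nlinarith [mul_nonneg hη.le (sq_nonneg (d t))]
    have h2 := hanti (left_mem_Icc.2 ht1.1.1) (right_mem_Icc.2 ht1.1.1) ht1.1.1
    have h3 := low t1 ht1.1.1
    have h4 : σ ^ 2 ≤ d t1 ^ 2 := pow_le_pow_left₀ hσ ht1.2 2
    nlinarith
  have hanti : AntitoneOn (fun t => L t * Real.exp (2 * (η / B) * (t - t₀))) (Ici t₀) := by
    apply antitoneOn_of_deriv_nonpos (convex_Ici _) (Lc.mul (by fun_prop))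
    · intro t ht
      rw [interior_Ici] at ht
      exact ((hL t ht).differentiableAt.mul (by fun_prop)).differentiableWithinAt
    · intro t ht
      rw [interior_Ici] at ht
      have ht' : t₀ < t := ht
      have he : HasDerivAt (fun t => Real.exp (2 * (η / B) * (t - t₀)))
          (Real.exp (2 * (η / B) * (t - t₀)) * (2 * (η / B))) t := by
        have := (((hasDerivAt_id t).sub_const t₀).const_mul (2 * (η / B))).exp
        simpa using this
      have hh := (hL t ht).mul he
      have hde : deriv (fun t => L t * Real.exp (2 * (η / B) * (t - t₀))) t = _ := hh.deriv
      refine le_of_eq_of_le hde ?_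
      have e0 := Real.exp_pos (2 * (η / B) * (t - t₀))
      have a1 := hdis t ht (bd t ht'.le)
      have a2 := up t ht'.le (bd t ht'.le)
      have a3 : η / B * L t ≤ η * d t ^ 2 := by
        calc η / B * L t ≤ η / B * (B * d t ^ 2) := by gcongr
          _ = η * d t ^ 2 := by field_simp
      have : 2 * L' t + L t * (2 * (η / B)) ≤ 0 := by linarith
      calc _ = (2 * L' t + L t * (2 * (η / B))) * Real.exp (2 * (η / B) * (t - t₀)) := by ring
        _ ≤ 0 := mul_nonpos_of_nonpos_of_nonneg this e0.le
  intro t ht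
  have b1 := hanti self_mem_Ici ht ht
  simp only [sub_self, mul_zero, Real.exp_zero, mul_one] at b1
  have b2 := up t₀ le_rfl h0.le
  have b3 := low t ht
  set X := Real.exp (-(η / B) * (t - t₀)) with hX
  have hX0 : 0 < X := Real.exp_pos _
  have hXe : Real.exp (2 * (η / B) * (t - t₀)) * X ^ 2 = 1 := by
    rw [hX, ← Real.exp_nat_mul, ← Real.exp_add, ← Real.exp_zero]
    congr 1
    push_cast
    ring
  have b4 : L t ≤ B * d t₀ ^ 2 * X ^ 2 := by
    calc L t = L t * (Real.exp (2 * (η / B) * (t - t₀)) * X ^ 2) := by rw [hXe, mul_one]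
      _ = (L t * Real.exp (2 * (η / B) * (t - t₀))) * X ^ 2 := by ring
      _ ≤ _ := mul_le_mul_of_nonneg_right (b1.trans b2) (sq_nonneg X)
  refine (sq_le_sq₀ (d0 t) (mul_nonneg (by positivity) (d0 t₀))).1 ?_
  rw [mul_pow, mul_pow, Real.sq_sqrt (by positivity)]
  calc d t ^ 2 = (κ * d t ^ 2) / κ := by field_simp
    _ ≤ (B * d t₀ ^ 2 * X ^ 2) / κ := div_le_div_of_nonneg_right (b3.trans b4) hκ.le
    _ = _ := by ring

lemma eps_bound {ε ε' : ℝ → ℝ} {μ M : ℝ} (hμ : 0 < μ)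
    (hε : ∀ t ∈ Ici (0:ℝ), HasDerivWithinAt ε (ε' t) (Ici 0) t) (h0 : 0 ≤ ε 0)
    (h : ∀ t, 0 < t → ε' t + μ * ε t ≤ M) (hM : 0 ≤ M) (t : ℝ) (ht : 0 ≤ t) :
    ε t ≤ M / μ + ε 0 := by
  have hanti : AntitoneOn (fun t => (ε t - M / μ) * Real.exp (μ * t)) (Ici 0) := by
    apply antitoneOn_of_deriv_nonpos (convex_Ici _)
    · have cε : ContinuousOn ε (Ici 0) := fun t ht => (hε t ht).continuousWithinAt
      exact (cε.sub continuousOn_const).mul (by fun_prop)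
    · intro t ht
      rw [interior_Ici] at ht
      exact ((((hε t (mem_Ici.2 (le_of_lt (mem_Ioi.1 ht)))).hasDerivAt (Ici_mem_nhds ht)).differentiableAt.sub_const
        _).mul (by fun_prop)).differentiableWithinAt
    · intro t ht
      rw [interior_Ici] at ht
      have d1 := ((hε t (mem_Ici.2 (le_of_lt (mem_Ioi.1 ht)))).hasDerivAt (Ici_mem_nhds ht)).sub_const (M / μ)
      have d2 : HasDerivAt (fun t => Real.exp (μ * t)) (Real.exp (μ * t) * μ) t := by
        simpa using ((hasDerivAt_id t).const_mul μ).exp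
      have hde : deriv (fun t => (ε t - M / μ) * Real.exp (μ * t)) t = _ := (d1.mul d2).deriv
      refine le_of_eq_of_le hde ?_
      have e0 := Real.exp_pos (μ * t)
      have a1 := h t ht
      have a2 : (ε t - M / μ) * μ = μ * ε t - M := by field_simp
      calc _ = (ε' t + (ε t - M / μ) * μ) * Real.exp (μ * t) := by ring
        _ ≤ 0 := mul_nonpos_of_nonpos_of_nonneg (by linarith) e0.le
  have b := hanti self_mem_Ici ht ht
  simp only [mul_zero, Real.exp_zero, mul_one] at b
  by_contra! hc
  have e1 : 1 ≤ Real.exp (μ * t) := Real.one_le_exp (by positivity)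
  have hq : 0 ≤ M / μ := by positivity
  nlinarith

set_option maxHeartbeats 1000000
/-- Theorem 4.1, part 4 (eventual exponential-asymptotic stability in the
large): with `ρ = ∞`, `0 ≤ τ < 1`, `sup_(t>0) g(t) < ∞` and `C'(t) → 0` as
`t → ∞`, the null solution is eventually exponential-asymptotically stable in
the large. -/
theorem null_solution_eventually_exp_asymptotically_stable_in_the_large
    (ε ε' ε'' C C' F F' : ℝ → ℝ) (a' A τ k μ Cbar εbar ebar : ℝ)
    (hεderiv : ∀ t ∈ Ici (0:ℝ), HasDerivWithinAt ε (ε' t) (Ici 0) t)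
    (hε'deriv : ∀ t ∈ Ici (0:ℝ), HasDerivWithinAt ε' (ε'' t) (Ici 0) t)
    (hε''cont : ContinuousOn ε'' (Ici 0))
    (hεnonneg : ∀ t ∈ Ici (0:ℝ), 0 ≤ ε t)
    (hCderiv : ∀ t ∈ Ici (0:ℝ), HasDerivWithinAt C (C' t) (Ici 0) t)
    (hC'cont : ContinuousOn C' (Ici 0))
    (hFderiv : ∀ z, HasDerivAt F (F' z) z)
    (hF'cont : Continuous F')
    (hF0 : F 0 = 0)
    (hCbar : IsGLB (C '' Ioi (0:ℝ)) Cbar) (hCbarpos : 0 < Cbar)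
    (hεbar : IsGLB (ε '' Ioi (0:ℝ)) εbar)
    (hebar : IsGLB (ε'' '' Ioi (0:ℝ)) ebar)
    (hA : 0 ≤ A) (hτ : 0 ≤ τ) (hk : 0 ≤ k) (hμ : 0 < μ)
    (hFk : ∀ z, F' z ≤ k)
    (hCk : k ≤ Cbar)
    (hdiss : ∀ t ∈ Ici (0:ℝ), μ * (1 + ε t) ≤ C t - ε' t)
    (hmuk : 0 < μ + Cbar / 2 - 2 * k)
    (ha' : 0 ≤ a')
    (ha'ε : 0 < a' + εbar / 2)
    (hτ1 : τ < 1)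
    (hg : ∃ gM, ∀ t ∈ Ioi (0:ℝ), C t - ε' t / 2 + 1 ≤ gM)
    (hC' : Tendsto C' atTop (nhds 0))
    :
    ∀ δ, 0 < δ →
      ∃ s, 0 ≤ s ∧ ∃ D, 0 < D ∧ ∃ E, 0 < E ∧
        ∀ t₀, s ≤ t₀ →
          ∀ S : ClassicalSolution ε C F a' t₀,
            (∀ x ∈ Icc (0:ℝ) π, ∀ t ∈ Ici t₀, S.aa x t ≤ A * S.d t ^ τ) →
            S.d t₀ ≤ δ →
            ∀ t, t₀ ≤ t → S.d t ≤ D * Real.exp (-E * (t - t₀)) * S.d t₀ := by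
  intro δ hδ
  obtain ⟨gM, hgM⟩ := hg
  have hCb : ∀ t, 0 < t → Cbar ≤ C t := fun t ht => hCbar.1 ⟨t, ht, rfl⟩
  have hεb : ∀ t, 0 < t → εbar ≤ ε t := fun t ht => hεbar.1 ⟨t, ht, rfl⟩
  have heb : ∀ t, 0 < t → ebar ≤ ε'' t := fun t ht => hebar.1 ⟨t, ht, rfl⟩
  have hεb0 : 0 ≤ εbar := by
    apply hεbar.2
    rintro _ ⟨t, ht, rfl⟩
    exact hεnonneg t (mem_Ici.2 (le_of_lt (mem_Ioi.1 ht)))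
  have hFc : Continuous F := continuous_iff_continuousAt.2 fun z => (hFderiv z).continuousAt
  have cε : ContinuousOn ε (Ici 0) := fun t ht => (hεderiv t ht).continuousWithinAt
  have cε' : ContinuousOn ε' (Ici 0) := fun t ht => (hε'deriv t ht).continuousWithinAt
  have cC : ContinuousOn C (Ici 0) := fun t ht => (hCderiv t ht).continuousWithinAt
  obtain ⟨M, hMdef⟩ : ∃ M, M = 2 * gM := ⟨_, rfl⟩
  have hfac : ∀ t, 0 < t → C t ≤ M ∧ ε' t ≤ M ∧ -ε' t ≤ M ∧ ε' t + μ * ε t ≤ M := by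
    intro t ht
    have h1 := hgM t ht
    have h2 := hdiss t (mem_Ici.2 ht.le)
    have h3 := hCb t ht
    have h4 := mul_nonneg hμ.le (hεnonneg t (mem_Ici.2 ht.le))
    refine ⟨?_, ?_, ?_, ?_⟩ <;> nlinarith
  have hM0 : 0 ≤ M := by
    have := (hfac 1 one_pos).1
    have := hCb 1 one_pos
    linarith
  obtain ⟨eM, heMdef⟩ : ∃ eM, eM = M / μ + ε 0 := ⟨_, rfl⟩
  have hε0 := hεnonneg 0 self_mem_Ici
  have heM0 : 0 ≤ eM := by rw [heMdef]; positivity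
  have heM : ∀ t, 0 ≤ t → ε t ≤ eM := fun t ht => by
    rw [heMdef]
    exact eps_bound hμ hεderiv hε0 (fun t ht => (hfac t ht).2.2.2) hM0 t ht
  obtain ⟨θ, hθ, hθ1⟩ : ∃ θ : ℝ, 0 ≤ θ ∧
      eM * k + 1 / 2 - ebar / 2 + a' * M / 2 + 1 ≤ θ * (Cbar / 4) := by
    refine ⟨|eM * k + 1 / 2 - ebar / 2 + a' * M / 2 + 1| / (Cbar / 4), by positivity, ?_⟩
    rw [div_mul_cancel₀ _ (by positivity)]
    exact le_abs_self _
  obtain ⟨κ, hκ, hκ1, hκ2⟩ : ∃ κ : ℝ, 0 < κ ∧ κ ≤ 1 / 2 ∧ κ ≤ Cbar / 8 :=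
    ⟨min (1 / 2) (Cbar / 8), lt_min (by norm_num) (by positivity), min_le_left _ _,
      min_le_right _ _⟩
  obtain ⟨η, hη, hη1, hη2⟩ : ∃ η : ℝ, 0 < η ∧ η ≤ μ / 2 ∧ η ≤ 1 / 4 :=
    ⟨min (μ / 2) (1 / 4), lt_min (by positivity) (by norm_num), min_le_left _ _,
      min_le_right _ _⟩
  obtain ⟨γ2, hγ2⟩ : ∃ γ2, γ2 = A * (1 / (2 * μ) + θ ^ 2) := ⟨_, rfl⟩
  obtain ⟨γ1, hγ1⟩ : ∃ γ1, γ1 = (8 * θ ^ 2 / Cbar + 2) + (θ + 1) / (a' + εbar / 2) := ⟨_, rfl⟩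
  have hγ20 : 0 ≤ γ2 := by rw [hγ2]; positivity
  have hp1 : 0 ≤ 8 * θ ^ 2 / Cbar := by positivity
  have hp2 : 0 ≤ (θ + 1) / (a' + εbar / 2) := by positivity
  have hγ10 : 0 ≤ γ1 := by rw [hγ1]; linarith
  obtain ⟨mδ, hmδ, hmδF⟩ := F_lip hFderiv hF'cont hF0 (π / 2 + δ ^ 2 / 2)
  obtain ⟨H, hH⟩ : ∃ H, H = 2 + θ + 2 * M + eM * (a' + θ) + a' * θ + mδ := ⟨_, rfl⟩
  have hH0 : 0 ≤ H := by rw [hH]; positivity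
  obtain ⟨σ, hσ1, hσδ, hσH⟩ : ∃ σ : ℝ, 1 ≤ σ ∧ δ < σ ∧ (1 + γ1 + γ2) * H * δ ^ 2 / κ < σ := by
    have hq : 0 ≤ (1 + γ1 + γ2) * H * δ ^ 2 / κ := by positivity
    exact ⟨1 + δ + (1 + γ1 + γ2) * H * δ ^ 2 / κ, by linarith, by linarith, by linarith⟩
  have hσ0 : 0 < σ := by linarith
  have hστ : σ ^ τ ≤ σ := by
    calc σ ^ τ ≤ σ ^ (1:ℝ) := Real.rpow_le_rpow_of_exponent_le hσ1 hτ1.le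
      _ = σ := Real.rpow_one σ
  have hστ0 : 0 ≤ σ ^ τ := Real.rpow_nonneg hσ0.le _
  obtain ⟨γ, hγ⟩ : ∃ γ, γ = γ1 + γ2 * σ ^ τ := ⟨_, rfl⟩
  have hγ2' : 0 ≤ γ2 * σ ^ τ := by positivity
  have hγ0 : 0 ≤ γ := by rw [hγ]; positivity
  have hγa : A * σ ^ τ * (1 / (2 * μ) + θ ^ 2) ≤ γ := by
    rw [hγ, hγ2]
    nlinarith
  have hγb : θ + 1 ≤ γ * (a' + εbar / 2) := by
    have h1 : (θ + 1) / (a' + εbar / 2) ≤ γ := by rw [hγ, hγ1]; linarith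
    exact (div_le_iff₀ ha'ε).1 h1
  have hγc : 8 * θ ^ 2 / Cbar + 2 ≤ γ := by rw [hγ, hγ1]; linarith
  have hγσ : 1 + γ ≤ (1 + γ1 + γ2) * σ := by
    rw [hγ]
    nlinarith [mul_le_mul_of_nonneg_left hστ hγ20]
  have hstart : (1 + γ) * H * δ ^ 2 < κ * σ ^ 2 := by
    rw [div_lt_iff₀ hκ] at hσH
    calc (1 + γ) * H * δ ^ 2 ≤ (1 + γ1 + γ2) * σ * H * δ ^ 2 := by gcongr
      _ = ((1 + γ1 + γ2) * H * δ ^ 2) * σ := by ring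
      _ < (σ * κ) * σ := by gcongr
      _ = κ * σ ^ 2 := by ring
  obtain ⟨mσ, hmσ, hmσF⟩ := F_lip hFderiv hF'cont hF0 (π / 2 + σ ^ 2 / 2)
  obtain ⟨B, hB⟩ : ∃ B, B = (1 + γ) * (2 + θ + 2 * M + eM * (a' + θ) + a' * θ + mσ) := ⟨_, rfl⟩
  have hB0 : 0 < B := by rw [hB]; positivity
  obtain ⟨s, hs1, hs⟩ : ∃ s : ℝ, 1 ≤ s ∧ ∀ t, s ≤ t → C' t * (1 + γ) ≤ 1 := by
    have h1 : ∀ᶠ t in atTop, C' t < 1 / (1 + γ) :=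
      hC'.eventually_lt_const (by positivity)
    obtain ⟨s, hs⟩ := eventually_atTop.1 h1
    refine ⟨max 1 s, le_max_left _ _, fun t ht => ?_⟩
    have := hs t ((le_max_right _ _).trans ht)
    rw [lt_div_iff₀ (by positivity)] at this
    exact this.le
  refine ⟨s, by linarith, Real.sqrt (B / κ), by positivity, η / B, by positivity, ?_⟩
  intro t₀ ht₀ S haa hd
  have h0 : 0 ≤ t₀ := by linarith
  have hpos : ∀ t, t₀ ≤ t → 0 < t := fun t ht => by linarith
  refine abstract_decay (d := S.d) (L := fun t => ∫ x in (0:ℝ)..π, phi S ε' γ θ x t)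
    (L' := fun t => ∫ x in (0:ℝ)..π, phit S ε' ε'' C' γ θ x t) (σ := σ) (d_cont S h0 cε)
    (cont_int Real.pi_pos.le (phi_cont S h0 hFc cε cε' cC γ θ)) (d_nonneg S)
    (fun t ht => energy_deriv S h0 hFc hεderiv hε'deriv hε''cont hCderiv hC'cont γ θ ht)
    ?_ ?_ ?_ (hd.trans_lt hσδ) ?_ hκ hη hB0
  · intro t ht hdσ
    have htp := hpos t ht.le
    have htp' : t ∈ Ici (0:ℝ) := mem_Ici.2 htp.le
    refine energy_dissip S h0 hFderiv hF'cont hF0 cε cε' hε''cont cC hC'cont (A := A * σ ^ τ)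
      (c0 := a' + εbar / 2) ht hFk (hεnonneg t htp') (heM t htp.le) hk hμ (hdiss t htp')
      (hCb t htp) hmuk.le ?_ (hfac t htp).2.1 ha' (heb t htp) (hs t (ht₀.trans ht.le)) hθ hθ1
      hγ0 hγa hγb ?_ hη1 hη2
    · intro x hx
      refine (haa x hx t (mem_Ici.2 ht.le)).trans ?_
      exact mul_le_mul_of_nonneg_left (Real.rpow_le_rpow (d_nonneg S t) hdσ hτ) hA
    · have := hεb t htp
      linarith
  · intro t ht
    have htp := hpos t ht
    have htp' : t ∈ Ici (0:ℝ) := mem_Ici.2 htp.le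
    exact energy_lower S h0 hFderiv hF0 cε cε' cC ht hFk (hεnonneg t htp') hk hμ hCbarpos hCk
      (hdiss t htp') (hCb t htp) hmuk.le ha' hθ hγc hκ1 hκ2
  · intro t ht hdσ
    have htp := hpos t ht
    have htp' : t ∈ Ici (0:ℝ) := mem_Ici.2 htp.le
    rw [hB]
    exact energy_upper S h0 hFc cε cε' cC ht hmσ hmσF hdσ (hεnonneg t htp') (heM t htp.le) hM0
      (hfac t htp).1 (hfac t htp).2.2.1 ha' hθ hγ0
  · have htp := hpos t₀ le_rfl
    have htp' : t₀ ∈ Ici (0:ℝ) := mem_Ici.2 htp.le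
    have hu := energy_upper S h0 hFc cε cε' cC (le_refl t₀) hmδ hmδF hd (hεnonneg t₀ htp')
      (heM t₀ htp.le) hM0 (hfac t₀ htp).1 (hfac t₀ htp).2.2.1 ha' hθ hγ0
    rw [← hH] at hu
    refine lt_of_le_of_lt (hu.trans ?_) hstart
    have hdd : S.d t₀ ^ 2 ≤ δ ^ 2 := pow_le_pow_left₀ (d_nonneg S t₀) hd 2
    gcongr
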